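/- Let d ≥ 1, α ∈ (0,2), κ₁ ≥ 1, and let κ : ℝ^d → ℝ be measurable with 1 ≤ κ(y) ≤ κ₁ for all y. Then there exists a constant C = C(d,α) > 0 such that for all z = (x,v) ∈ ℝ^d × ℝ^d, S(z) ≤ C · κ₁^{3+2d+2α} · (|z|+1)^{−(d+α)} · ∫_0^1 (|x − s v| + 1)^{−(d+α)} ds. -/

import Mathlib

open MeasureTheory Real RealInnerProductSpace

/-- Total mass `λ` of the large-jump Lévy measure. -/
noncomputable def bigLam (d : ℕ) (α : ℝ) (κ : EuclideanSpace ℝ (Fin d) → ℝ) : ℝ :=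
  ∫ y in {y : EuclideanSpace ℝ (Fin d) | 1 < ‖y‖}, κ y * ‖y‖ ^ (-(d : ℝ) - α)

/-- `S(z)`: the probability that the large-jump part `Z₁^{(1)}` lies in the unit cube
`Q₁(z)`, written as an explicit series of iterated integrals. -/
noncomputable def bigS (d : ℕ) (α : ℝ) (κ : EuclideanSpace ℝ (Fin d) → ℝ)
    (x v : EuclideanSpace ℝ (Fin d)) : ℝ :=
  ∑' n : ℕ,
    (Real.exp (-(bigLam d α κ)) / (Nat.factorial (n + 1) : ℝ)) *
      ∫ s in Set.univ.pi fun _ : Fin (n + 1) => Set.Icc (0 : ℝ) 1,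
        ∫ y : Fin (n + 1) → EuclideanSpace ℝ (Fin d),
          (if ‖(∑ j, s j • y j) - x‖ ≤ 1 then (1 : ℝ) else 0) *
            (if ‖(∑ j, y j) - v‖ ≤ 1 then (1 : ℝ) else 0) *
            ∏ j, (if 1 < ‖y j‖ then κ (y j) * ‖y j‖ ^ (-(d : ℝ) - α) else 0)

open scoped ENNReal

open scoped ENNReal

theorem lintegral_pi_succAbove {E : Type*} [MeasureSpace E] [SigmaFinite (volume : Measure E)]
    {n : ℕ} (j : Fin (n + 1)) {F : (Fin (n + 1) → E) → ℝ≥0∞} (hF : Measurable F) :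
    ∫⁻ y, F y = ∫⁻ y' : Fin n → E, ∫⁻ t : E, F (j.insertNth t y') := by
  have h := (volume_preserving_piFinSuccAbove (fun _ : Fin (n + 1) => E) j).symm
  rw [← h.lintegral_comp hF, Measure.volume_eq_prod]
  exact lintegral_prod_symm _ (hF.comp (MeasurableEquiv.measurable _)).aemeasurable

theorem lintegral_pi_prod_eq_pow {E : Type*} [MeasureSpace E] [SigmaFinite (volume : Measure E)]
    {g : E → ℝ≥0∞} (hg : Measurable g) (n : ℕ) :
    ∫⁻ y : Fin n → E, ∏ k, g (y k) = (∫⁻ t, g t) ^ n := by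
  induction n with
  | zero => simp [volume_pi]
  | succ n ih =>
    rw [lintegral_pi_succAbove 0 (by fun_prop)]
    simp only [Fin.prod_univ_succAbove _ (0 : Fin (n + 1)), Fin.insertNth_apply_same,
      Fin.insertNth_apply_succAbove]
    simp_rw [lintegral_mul_const _ hg]
    rw [lintegral_const_mul _ (by fun_prop), ih, pow_succ']

theorem lintegral_unitCube_eval {h : ℝ → ℝ≥0∞} (hh : Measurable h) {n : ℕ} (j : Fin n) :
    ∫⁻ s in Set.univ.pi fun _ : Fin n => Set.Icc (0 : ℝ) 1, h (s j) =
      ∫⁻ r in Set.Icc (0 : ℝ) 1, h r := by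
  have : IsProbabilityMeasure ((volume : Measure ℝ).restrict (Set.Icc 0 1)) := ⟨by simp⟩
  rw [volume_pi, Measure.restrict_pi_pi]
  exact (measurePreserving_eval (fun _ : Fin n => (volume : Measure ℝ).restrict (Set.Icc 0 1))
    j).lintegral_comp hh

theorem tsum_poisson_moment_le {l : ℝ} (hl : 0 ≤ l) (m c : ℕ) :
    ∑' k : ℕ, ENNReal.ofReal (((k + c : ℕ) : ℝ) ^ m * (l ^ k / k.factorial)) ≤
      ENNReal.ofReal ((c + m + l) ^ m * Real.exp l) := by
  induction m generalizing c with
  | zero =>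
    simp only [pow_zero, one_mul]
    rw [← ENNReal.ofReal_tsum_of_nonneg (fun n => by positivity) (Real.summable_pow_div_factorial l),
      Real.exp_eq_exp_ℝ, NormedSpace.exp_eq_tsum_div]
  | succ m ih =>
    have hsplit : ∀ k : ℕ, ENNReal.ofReal (((k + c : ℕ) : ℝ) ^ (m + 1) * (l ^ k / k.factorial)) =
        ENNReal.ofReal c * ENNReal.ofReal (((k + c : ℕ) : ℝ) ^ m * (l ^ k / k.factorial)) +
        ENNReal.ofReal (k * (((k + c : ℕ) : ℝ) ^ m * (l ^ k / k.factorial))) := by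
      intro k
      rw [← ENNReal.ofReal_mul (by positivity), ← ENNReal.ofReal_add (by positivity) (by positivity)]
      congr 1
      push_cast
      ring
    have hshift : ∀ k : ℕ, ENNReal.ofReal (((k + 1 : ℕ) : ℝ) * (((k + 1 + c : ℕ) : ℝ) ^ m *
        (l ^ (k + 1) / (k + 1).factorial))) =
        ENNReal.ofReal l * ENNReal.ofReal (((k + (1 + c) : ℕ) : ℝ) ^ m * (l ^ k / k.factorial)) := by
      intro k
      rw [← ENNReal.ofReal_mul hl, Nat.factorial_succ, add_assoc]
      congr 1
      push_cast
      field_simp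
      ring
    simp_rw [hsplit]
    rw [ENNReal.tsum_add, ENNReal.tsum_mul_left,
      tsum_eq_zero_add' (f := fun k : ℕ => ENNReal.ofReal (k * (((k + c : ℕ) : ℝ) ^ m *
        (l ^ k / k.factorial)))) ENNReal.summable]
    simp_rw [hshift]
    rw [ENNReal.tsum_mul_left]
    simp only [Nat.cast_zero, zero_mul, ENNReal.ofReal_zero, zero_add]
    refine (add_le_add (mul_le_mul_right (ih c) _) (mul_le_mul_right (ih (1 + c)) _)).trans ?_
    rw [← ENNReal.ofReal_mul (by positivity), ← ENNReal.ofReal_mul hl,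
      ← ENNReal.ofReal_add (by positivity) (by positivity)]
    refine ENNReal.ofReal_le_ofReal ?_
    have e : ((1 + c : ℕ) : ℝ) + m + l = c + (m + 1 : ℕ) + l := by push_cast; ring
    rw [e]
    have h1 : (c + m + l) ^ m ≤ ((c : ℝ) + (m + 1 : ℕ) + l) ^ m := by gcongr; simp
    have hx := Real.exp_pos l
    calc _ ≤ c * (((c : ℝ) + (m + 1 : ℕ) + l) ^ m * Real.exp l) +
          l * (((c : ℝ) + (m + 1 : ℕ) + l) ^ m * Real.exp l) := by gcongr
      _ = (c + l) * (((c : ℝ) + (m + 1 : ℕ) + l) ^ m * Real.exp l) := by ring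
      _ ≤ ((c : ℝ) + (m + 1 : ℕ) + l) * (((c : ℝ) + (m + 1 : ℕ) + l) ^ m * Real.exp l) := by
        gcongr
        simp only [le_add_iff_nonneg_right]; positivity
      _ = _ := by ring

theorem lintegral_affine_ball_le {d : ℕ} {α r : ℝ} (hα : 0 < α) (hr : |r| ≤ 1)
    (w : EuclideanSpace ℝ (Fin d)) :
    ∫⁻ t : EuclideanSpace ℝ (Fin d), ENNReal.ofReal (|r| ^ ((d : ℝ) + α)) *
        (if ‖r • t - w‖ ≤ 2 then 1 else 0) ≤
      volume (Metric.closedBall (0 : EuclideanSpace ℝ (Fin d)) 2) := by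
  rcases eq_or_ne r 0 with rfl | h0
  · have : (0 : ℝ) < d + α := by positivity
    simp [Real.zero_rpow this.ne']
  have hm : MeasurableSet {t : EuclideanSpace ℝ (Fin d) | ‖r • t - w‖ ≤ 2} :=
    measurableSet_le (by fun_prop) (by fun_prop)
  have hset : {t : EuclideanSpace ℝ (Fin d) | ‖r • t - w‖ ≤ 2} =
      (r • ·) ⁻¹' Metric.closedBall w 2 := by
    ext t; simp [dist_eq_norm]
  have hind : ∀ t : EuclideanSpace ℝ (Fin d), (if ‖r • t - w‖ ≤ 2 then (1 : ℝ≥0∞) else 0) =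
      {t : EuclideanSpace ℝ (Fin d) | ‖r • t - w‖ ≤ 2}.indicator 1 t := fun t => by
    simp [Set.indicator_apply]
  simp_rw [hind]
  rw [lintegral_const_mul _ (measurable_one.indicator hm), lintegral_indicator_one hm, hset,
    Measure.addHaar_preimage_smul _ h0, Measure.addHaar_closedBall_center, ← mul_assoc,
    ← ENNReal.ofReal_mul (by positivity)]
  have hpos : 0 < |r| := abs_pos.2 h0
  refine mul_le_of_le_one_left' (ENNReal.ofReal_le_one.2 ?_)
  rw [finrank_euclideanSpace_fin, abs_inv, abs_pow, Real.rpow_add hpos, Real.rpow_natCast,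
    mul_right_comm, mul_inv_cancel₀ (by positivity), one_mul]
  exact Real.rpow_le_one hpos.le hr hα.le

theorem lintegral_unit_ball_indicator {d : ℕ} (w : EuclideanSpace ℝ (Fin d)) :
    ∫⁻ t : EuclideanSpace ℝ (Fin d), (if ‖t - w‖ ≤ 1 then (1 : ℝ≥0∞) else 0) =
      volume (Metric.closedBall (0 : EuclideanSpace ℝ (Fin d)) 1) := by
  have hind : ∀ t : EuclideanSpace ℝ (Fin d), (if ‖t - w‖ ≤ 1 then (1 : ℝ≥0∞) else 0) =
      (Metric.closedBall w 1).indicator (1 : EuclideanSpace ℝ (Fin d) → ℝ≥0∞) t := fun t => by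
    by_cases h : ‖t - w‖ ≤ 1 <;> simp [h, dist_eq_norm]
  simp_rw [hind]
  rw [lintegral_indicator_one Metric.isClosed_closedBall.measurableSet,
    Measure.addHaar_closedBall_center]

theorem measurable_ite_norm_le {X E : Type*} [MeasurableSpace X] [NormedAddCommGroup E]
    [MeasurableSpace E] [OpensMeasurableSpace E] {f : X → E} (hf : Measurable f) (c : ℝ) :
    Measurable fun y => if ‖f y‖ ≤ c then (1 : ℝ≥0∞) else 0 :=
  Measurable.ite (measurableSet_le hf.norm measurable_const) measurable_const measurable_const

theorem lintegral_second_jump_le {d n : ℕ} {α : ℝ} (hα : 0 < α)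
    {g : EuclideanSpace ℝ (Fin d) → ℝ≥0∞} (hg : Measurable g) {u : Fin n → ℝ}
    (w : EuclideanSpace ℝ (Fin d)) (i : Fin n) (hu : |u i| ≤ 1) :
    ∫⁻ y : Fin n → EuclideanSpace ℝ (Fin d), ENNReal.ofReal (|u i| ^ ((d : ℝ) + α)) *
        (if ‖(∑ k, u k • y k) - w‖ ≤ 2 then 1 else 0) * ∏ k ∈ Finset.univ.erase i, g (y k) ≤
      volume (Metric.closedBall (0 : EuclideanSpace ℝ (Fin d)) 2) * (∫⁻ t, g t) ^ (n - 1) := by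
  obtain _ | n := n
  · exact i.elim0
  have hprod : ∀ y : Fin (n + 1) → EuclideanSpace ℝ (Fin d),
      ∏ k ∈ Finset.univ.erase i, g (y k) = ∏ k, g (y (i.succAbove k)) := fun y => by
    rw [Fin.univ_succAbove _ i, Finset.erase_cons, Finset.prod_map]
    rfl
  simp_rw [hprod]
  rw [lintegral_pi_succAbove i (by
    refine Measurable.mul (measurable_const.mul (measurable_ite_norm_le (by fun_prop) _)) ?_
    fun_prop)]
  simp only [Fin.insertNth_apply_succAbove, Fin.sum_univ_succAbove _ i, Fin.insertNth_apply_same]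
  rw [Nat.add_sub_cancel, ← lintegral_pi_prod_eq_pow hg, ← lintegral_const_mul _ (by fun_prop)]
  refine lintegral_mono fun y' => ?_
  have hm : Measurable fun t : EuclideanSpace ℝ (Fin d) =>
      ENNReal.ofReal (|u i| ^ ((d : ℝ) + α)) *
        (if ‖u i • t + ∑ k, u (i.succAbove k) • y' k - w‖ ≤ 2 then 1 else 0) :=
    measurable_const.mul (measurable_ite_norm_le (by fun_prop) _)
  rw [lintegral_mul_const _ hm]
  refine mul_le_mul_left ?_ _
  simp_rw [add_sub_assoc, ← sub_neg_eq_add _ (_ - w)]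
  exact lintegral_affine_ball_le hα hu _

theorem exists_large_summand {E : Type*} [NormedAddCommGroup E] {n : ℕ} {f : Fin n → E} {w : E}
    (h : ‖(∑ k, f k) - w‖ ≤ 2) (hw : 6 < ‖w‖ + 1) :
    ∃ i, ‖w‖ + 1 ≤ 2 * ((n : ℝ) + 1) * ‖f i‖ := by
  by_contra! hc
  have h1 : ‖w‖ ≤ ‖∑ k, f k‖ + 2 := by
    have := norm_sub_norm_le w (∑ k, f k)
    rw [norm_sub_rev] at this
    linarith
  have h2 : 2 * ((n : ℝ) + 1) * ‖∑ k, f k‖ ≤ n * (‖w‖ + 1) := by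
    calc _ ≤ 2 * ((n : ℝ) + 1) * ∑ k, ‖f k‖ := by gcongr; exact norm_sum_le _ _
      _ = ∑ k, 2 * ((n : ℝ) + 1) * ‖f k‖ := Finset.mul_sum _ _ _
      _ ≤ ∑ _k : Fin n, (‖w‖ + 1) := Finset.sum_le_sum fun k _ => (hc k).le
      _ = _ := by simp [mul_add]
  have hn : (0 : ℝ) ≤ n := Nat.cast_nonneg n
  nlinarith

theorem exists_largest_jump {E : Type*} [NormedAddCommGroup E] [NormedSpace ℝ E] {n : ℕ}
    {s : Fin (n + 1) → ℝ} (hs : ∀ j, s j ∈ Set.Icc (0 : ℝ) 1) {y : Fin (n + 1) → E}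
    (hy : ∀ j, 1 < ‖y j‖) {x v : E} (hx : ‖(∑ j, s j • y j) - x‖ ≤ 1)
    (hv : ‖(∑ j, y j) - v‖ ≤ 1) :
    ∃ j, √(‖x‖ ^ 2 + ‖v‖ ^ 2) + 1 ≤ 5 * ((n : ℝ) + 1) * ‖y j‖ := by
  obtain ⟨j, -, hj⟩ := Finset.exists_max_image Finset.univ (fun j => ‖y j‖) ⟨0, Finset.mem_univ _⟩
  refine ⟨j, ?_⟩
  have hv' : ‖∑ k, y k‖ ≤ (n + 1) * ‖y j‖ := by
    refine (norm_sum_le _ _).trans ((Finset.sum_le_sum fun k hk => hj k hk).trans ?_)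
    simp
  have hx' : ‖∑ k, s k • y k‖ ≤ (n + 1) * ‖y j‖ := by
    refine (norm_sum_le _ _).trans
      ((Finset.sum_le_sum (g := fun _ => ‖y j‖) fun k hk => ?_).trans ?_)
    · rw [norm_smul, Real.norm_of_nonneg (hs k).1]
      exact (mul_le_of_le_one_left (norm_nonneg _) (hs k).2).trans (hj k hk)
    · simp
  have h1 : ‖x‖ ≤ ‖∑ k, s k • y k‖ + 1 := by
    have := norm_sub_norm_le x (∑ k, s k • y k)
    rw [norm_sub_rev] at this
    linarith
  have h2 : ‖v‖ ≤ ‖∑ k, y k‖ + 1 := by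
    have := norm_sub_norm_le v (∑ k, y k)
    rw [norm_sub_rev] at this
    linarith
  have h3 : √(‖x‖ ^ 2 + ‖v‖ ^ 2) ≤ ‖x‖ + ‖v‖ :=
    Real.sqrt_le_iff.2 ⟨by positivity, by nlinarith [norm_nonneg x, norm_nonneg v]⟩
  have hn : (0 : ℝ) ≤ n := Nat.cast_nonneg n
  nlinarith [hy j]

theorem norm_sum_relative_jumps_le {E : Type*} [NormedAddCommGroup E] [NormedSpace ℝ E] {n : ℕ}
    {s : Fin (n + 1) → ℝ} (hs : ∀ j, s j ∈ Set.Icc (0 : ℝ) 1) {y : Fin (n + 1) → E}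
    {x v : E} (hx : ‖(∑ j, s j • y j) - x‖ ≤ 1) (hv : ‖(∑ j, y j) - v‖ ≤ 1) (j : Fin (n + 1)) :
    ‖(∑ k, (s (j.succAbove k) - s j) • y (j.succAbove k)) - (x - s j • v)‖ ≤ 2 := by
  have h : (∑ k, (s (j.succAbove k) - s j) • y (j.succAbove k)) - (x - s j • v) =
      ((∑ j, s j • y j) - x) - s j • ((∑ j, y j) - v) := by
    rw [Fin.sum_univ_succAbove _ j, Fin.sum_univ_succAbove y j]
    simp only [sub_smul, Finset.sum_sub_distrib, smul_sub, smul_add, Finset.smul_sum]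
    abel
  rw [h]
  refine (norm_sub_le _ _).trans ?_
  rw [norm_smul, Real.norm_of_nonneg (hs j).1]
  have := mul_le_of_le_one_left (norm_nonneg ((∑ j, y j) - v)) (hs j).2
  linarith

theorem rpow_neg_le_of_le_mul {R c t β : ℝ} (hR : 0 < R) (hc : 0 ≤ c) (ht : 0 ≤ t) (hβ : 0 ≤ β)
    (h : R ≤ c * t) : t ^ (-β) ≤ c ^ β * R ^ (-β) := by
  have ht' : 0 < t := ht.lt_of_ne (by rintro rfl; simp at h; linarith)
  have := Real.rpow_le_rpow hR.le h hβ
  rw [Real.mul_rpow hc ht] at this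
  rw [Real.rpow_neg ht, Real.rpow_neg hR.le, ← div_eq_mul_inv, inv_eq_one_div,
    div_le_div_iff₀ (by positivity) (by positivity), one_mul]
  exact this

/-- Upper bound for the density of the jumps other than the largest one, where `u` are their time
offsets and `w` is the displacement they have to produce. -/
noncomputable def remainderBound {d n : ℕ} (α K : ℝ) (g : EuclideanSpace ℝ (Fin d) → ℝ≥0∞)
    (u : Fin n → ℝ) (w : EuclideanSpace ℝ (Fin d)) (y : Fin n → EuclideanSpace ℝ (Fin d)) : ℝ≥0∞ :=
  ENNReal.ofReal ((‖w‖ + 1) ^ (-((d : ℝ) + α))) *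
    (ENNReal.ofReal (6 ^ ((d : ℝ) + α)) * ∏ k, g (y k) +
      ∑ i, ENNReal.ofReal (K * (2 * ((n : ℝ) + 1)) ^ ((d : ℝ) + α)) *
        (ENNReal.ofReal (|u i| ^ ((d : ℝ) + α)) *
          (if ‖(∑ k, u k • y k) - w‖ ≤ 2 then 1 else 0) * ∏ k ∈ Finset.univ.erase i, g (y k)))

theorem measurable_remainderBound {d n : ℕ} (α K : ℝ) {g : EuclideanSpace ℝ (Fin d) → ℝ≥0∞}
    (hg : Measurable g) (u : Fin n → ℝ) (w : EuclideanSpace ℝ (Fin d)) :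
    Measurable (remainderBound α K g u w) := by
  unfold remainderBound
  refine measurable_const.mul (Measurable.add (by fun_prop)
    (Finset.measurable_fun_sum _ fun i _ => measurable_const.mul (Measurable.mul
      (measurable_const.mul (measurable_ite_norm_le (by fun_prop) _)) (by fun_prop))))

theorem lintegral_remainderBound_le {d n : ℕ} {α : ℝ} (hα : 0 < α) (K : ℝ)
    {g : EuclideanSpace ℝ (Fin d) → ℝ≥0∞} (hg : Measurable g) {u : Fin n → ℝ}
    (w : EuclideanSpace ℝ (Fin d)) (hu : ∀ i, |u i| ≤ 1) :
    ∫⁻ y, remainderBound α K g u w y ≤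
      ENNReal.ofReal ((‖w‖ + 1) ^ (-((d : ℝ) + α))) *
        (ENNReal.ofReal (6 ^ ((d : ℝ) + α)) * (∫⁻ t, g t) ^ n +
          n * (ENNReal.ofReal (K * (2 * ((n : ℝ) + 1)) ^ ((d : ℝ) + α)) *
            (volume (Metric.closedBall (0 : EuclideanSpace ℝ (Fin d)) 2) *
              (∫⁻ t, g t) ^ (n - 1)))) := by
  have hm : ∀ i, Measurable fun y : Fin n → EuclideanSpace ℝ (Fin d) =>
      ENNReal.ofReal (|u i| ^ ((d : ℝ) + α)) *
        (if ‖(∑ k, u k • y k) - w‖ ≤ 2 then 1 else 0) * ∏ k ∈ Finset.univ.erase i, g (y k) :=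
    fun i => Measurable.mul
      (measurable_const.mul (measurable_ite_norm_le (by fun_prop) _)) (by fun_prop)
  unfold remainderBound
  rw [lintegral_const_mul' _ _ ENNReal.ofReal_ne_top, lintegral_add_left (by fun_prop),
    lintegral_const_mul _ (by fun_prop), lintegral_pi_prod_eq_pow hg,
    lintegral_finsetSum _ fun i _ => (hm i).const_mul _]
  gcongr
  calc _ ≤ ∑ _i : Fin n, ENNReal.ofReal (K * (2 * ((n : ℝ) + 1)) ^ ((d : ℝ) + α)) *
            (volume (Metric.closedBall (0 : EuclideanSpace ℝ (Fin d)) 2) *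
              (∫⁻ t, g t) ^ (n - 1)) := by
        refine Finset.sum_le_sum fun i _ => ?_
        rw [lintegral_const_mul _ (hm i)]
        gcongr
        exact lintegral_second_jump_le hα hg w i (hu i)
    _ = _ := by simp

theorem prod_le_remainderBound {d n : ℕ} {α K : ℝ} (hα : 0 < α) (hK : 0 ≤ K)
    {g : EuclideanSpace ℝ (Fin d) → ℝ≥0∞}
    (hgK : ∀ t, g t ≤ ENNReal.ofReal (K * ‖t‖ ^ (-((d : ℝ) + α))))
    {u : Fin n → ℝ} {w : EuclideanSpace ℝ (Fin d)} {y : Fin n → EuclideanSpace ℝ (Fin d)}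
    (h : ‖(∑ k, u k • y k) - w‖ ≤ 2) :
    ∏ k, g (y k) ≤ remainderBound α K g u w y := by
  have hβ : 0 ≤ (d : ℝ) + α := by positivity
  have hw : 0 < ‖w‖ + 1 := by positivity
  unfold remainderBound
  rw [mul_add]
  by_cases hw6 : ‖w‖ + 1 ≤ 6
  · refine le_add_right ?_
    rw [← mul_assoc, ← ENNReal.ofReal_mul (by positivity)]
    refine le_mul_of_one_le_left' (ENNReal.one_le_ofReal.2 ?_)
    have := rpow_neg_le_of_le_mul (t := 1) hw (by norm_num : (0 : ℝ) ≤ 6) zero_le_one hβ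
      (by linarith)
    rwa [Real.one_rpow, mul_comm] at this
  · refine le_add_left ?_
    obtain ⟨i, hi⟩ := exists_large_summand h (not_le.1 hw6)
    rw [Finset.mul_sum]
    refine le_trans ?_ (Finset.single_le_sum (fun _ _ => zero_le) (Finset.mem_univ i))
    rw [if_pos h, mul_one, ← Finset.mul_prod_erase _ _ (Finset.mem_univ i), ← mul_assoc, ← mul_assoc,
      ← ENNReal.ofReal_mul (by positivity), ← ENNReal.ofReal_mul (by positivity)]
    gcongr
    refine (hgK _).trans (ENNReal.ofReal_le_ofReal ?_)
    rw [norm_smul, Real.norm_eq_abs, ← mul_assoc] at hi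
    have := rpow_neg_le_of_le_mul hw (by positivity) (norm_nonneg (y i)) hβ hi
    rw [Real.mul_rpow (by positivity) (abs_nonneg _)] at this
    calc _ ≤ K * _ := mul_le_mul_of_nonneg_left this hK
      _ = _ := by ring

theorem jump_density_le_sum {d n : ℕ} {α K : ℝ} (hα : 0 < α) (hK : 0 ≤ K)
    {g : EuclideanSpace ℝ (Fin d) → ℝ≥0∞}
    (hgK : ∀ t, g t ≤ ENNReal.ofReal (K * ‖t‖ ^ (-((d : ℝ) + α))))
    (hg0 : ∀ t, ‖t‖ ≤ 1 → g t = 0) {s : Fin (n + 1) → ℝ} (hs : ∀ j, s j ∈ Set.Icc (0 : ℝ) 1)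
    (x v : EuclideanSpace ℝ (Fin d)) (y : Fin (n + 1) → EuclideanSpace ℝ (Fin d)) :
    (if ‖(∑ j, s j • y j) - x‖ ≤ 1 then 1 else 0) * (if ‖(∑ j, y j) - v‖ ≤ 1 then 1 else 0) *
        ∏ j, g (y j) ≤
      ∑ j, ENNReal.ofReal (K * ((5 * ((n : ℝ) + 1)) ^ ((d : ℝ) + α) *
          (√(‖x‖ ^ 2 + ‖v‖ ^ 2) + 1) ^ (-((d : ℝ) + α)))) *
        ((if ‖y j - (v - ∑ k, y (j.succAbove k))‖ ≤ 1 then 1 else 0) *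
          remainderBound α K g (fun k => s (j.succAbove k) - s j) (x - s j • v)
            (fun k => y (j.succAbove k))) := by
  have hβ : 0 ≤ (d : ℝ) + α := by positivity
  by_cases hx : ‖(∑ j, s j • y j) - x‖ ≤ 1
  swap
  · simp [hx]
  by_cases hv : ‖(∑ j, y j) - v‖ ≤ 1
  swap
  · simp [hv]
  by_cases hy : ∀ j, 1 < ‖y j‖
  swap
  · push Not at hy
    obtain ⟨j, hj⟩ := hy
    rw [Finset.prod_eq_zero (f := fun j => g (y j)) (Finset.mem_univ j) (hg0 _ hj), mul_zero]
    exact zero_le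
  rw [if_pos hx, if_pos hv, one_mul, one_mul]
  obtain ⟨j, hj⟩ := exists_largest_jump hs hy hx hv
  refine le_trans ?_ (Finset.single_le_sum (fun _ _ => zero_le) (Finset.mem_univ j))
  have hvj : ‖y j - (v - ∑ k, y (j.succAbove k))‖ ≤ 1 := by
    rw [Fin.sum_univ_succAbove _ j] at hv
    rwa [sub_sub_eq_add_sub]
  rw [if_pos hvj, one_mul, Fin.prod_univ_succAbove _ j]
  refine mul_le_mul' ((hgK _).trans (ENNReal.ofReal_le_ofReal ?_))
    (prod_le_remainderBound hα hK hgK (norm_sum_relative_jumps_le hs hx hv j))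
  exact mul_le_mul_of_nonneg_left (rpow_neg_le_of_le_mul (by positivity) (by positivity)
    (norm_nonneg _) hβ hj) hK

theorem lintegral_jump_density_le {d n : ℕ} {α K : ℝ} (hα : 0 < α) (hK : 0 ≤ K)
    {g : EuclideanSpace ℝ (Fin d) → ℝ≥0∞} (hg : Measurable g)
    (hgK : ∀ t, g t ≤ ENNReal.ofReal (K * ‖t‖ ^ (-((d : ℝ) + α))))
    (hg0 : ∀ t, ‖t‖ ≤ 1 → g t = 0) {s : Fin (n + 1) → ℝ} (hs : ∀ j, s j ∈ Set.Icc (0 : ℝ) 1)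
    (x v : EuclideanSpace ℝ (Fin d)) :
    ∫⁻ y : Fin (n + 1) → EuclideanSpace ℝ (Fin d),
      (if ‖(∑ j, s j • y j) - x‖ ≤ 1 then 1 else 0) * (if ‖(∑ j, y j) - v‖ ≤ 1 then 1 else 0) *
        ∏ j, g (y j) ≤
      ∑ j, ENNReal.ofReal (K * ((5 * ((n : ℝ) + 1)) ^ ((d : ℝ) + α) *
          (√(‖x‖ ^ 2 + ‖v‖ ^ 2) + 1) ^ (-((d : ℝ) + α)))) *
        (volume (Metric.closedBall (0 : EuclideanSpace ℝ (Fin d)) 1) *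
          (ENNReal.ofReal ((‖x - s j • v‖ + 1) ^ (-((d : ℝ) + α))) *
            (ENNReal.ofReal (6 ^ ((d : ℝ) + α)) * (∫⁻ t, g t) ^ n +
              n * (ENNReal.ofReal (K * (2 * ((n : ℝ) + 1)) ^ ((d : ℝ) + α)) *
                (volume (Metric.closedBall (0 : EuclideanSpace ℝ (Fin d)) 2) *
                  (∫⁻ t, g t) ^ (n - 1)))))) := by
  have hm : ∀ j : Fin (n + 1), Measurable fun y : Fin (n + 1) → EuclideanSpace ℝ (Fin d) =>
      (if ‖y j - (v - ∑ k, y (j.succAbove k))‖ ≤ 1 then 1 else 0) *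
        remainderBound α K g (fun k => s (j.succAbove k) - s j) (x - s j • v)
          (fun k => y (j.succAbove k)) := fun j =>
    (measurable_ite_norm_le (by fun_prop) _).mul
      ((measurable_remainderBound α K hg _ _).comp (by fun_prop))
  refine (lintegral_mono (jump_density_le_sum hα hK hgK hg0 hs x v)).trans ?_
  rw [lintegral_finsetSum _ fun j _ => (hm j).const_mul _]
  refine Finset.sum_le_sum fun j _ => ?_
  rw [lintegral_const_mul _ (hm j), lintegral_pi_succAbove j (hm j)]
  gcongr
  simp only [Fin.insertNth_apply_succAbove, Fin.insertNth_apply_same]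
  have hm1 : ∀ y' : Fin n → EuclideanSpace ℝ (Fin d),
      Measurable fun t : EuclideanSpace ℝ (Fin d) =>
        if ‖t - (v - ∑ k, y' k)‖ ≤ 1 then (1 : ℝ≥0∞) else 0 :=
    fun y' => measurable_ite_norm_le (by fun_prop) _
  simp_rw [fun y' => lintegral_mul_const (μ := volume) (remainderBound α K g
    (fun k => s (j.succAbove k) - s j) (x - s j • v) y') (hm1 y'), lintegral_unit_ball_indicator]
  rw [lintegral_const_mul _ (measurable_remainderBound α K hg _ _)]
  gcongr
  refine lintegral_remainderBound_le hα K hg _ fun k => abs_le.2 ⟨?_, ?_⟩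
  · linarith [(hs (j.succAbove k)).1, (hs j).2]
  · linarith [(hs (j.succAbove k)).2, (hs j).1]

theorem integrableOn_norm_rpow_largeJumps (d : ℕ) {α : ℝ} (hα : 0 < α) :
    IntegrableOn (fun y : EuclideanSpace ℝ (Fin d) => ‖y‖ ^ (-(d : ℝ) - α)) {y | 1 < ‖y‖} := by
  have hβ : 0 ≤ (d : ℝ) + α := by positivity
  have h := (integrable_one_add_norm (E := EuclideanSpace ℝ (Fin d)) (μ := volume)
    (r := (d : ℝ) + α) (by simpa using hα)).const_mul (2 ^ ((d : ℝ) + α))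
  have hm : MeasurableSet {y : EuclideanSpace ℝ (Fin d) | 1 < ‖y‖} :=
    measurableSet_lt (by fun_prop) (by fun_prop)
  refine Integrable.mono' h.integrableOn (Measurable.aestronglyMeasurable (by fun_prop)) ?_
  filter_upwards [self_mem_ae_restrict hm] with y hy
  rw [Real.norm_of_nonneg (by positivity), show -(d : ℝ) - α = -((d : ℝ) + α) by ring]
  refine rpow_neg_le_of_le_mul (by positivity) (by norm_num) (norm_nonneg _) hβ ?_
  have : 1 < ‖y‖ := hy
  linarith

theorem integrableOn_largeJumps {d : ℕ} {α κ₁ : ℝ} (hα : 0 < α)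
    {κ : EuclideanSpace ℝ (Fin d) → ℝ} (hκm : Measurable κ) (hκ : ∀ y, 1 ≤ κ y ∧ κ y ≤ κ₁) :
    IntegrableOn (fun y : EuclideanSpace ℝ (Fin d) => κ y * ‖y‖ ^ (-(d : ℝ) - α))
      {y | 1 < ‖y‖} := by
  refine Integrable.mono' ((integrableOn_norm_rpow_largeJumps d hα).const_mul κ₁)
    (Measurable.aestronglyMeasurable (by fun_prop)) (Filter.Eventually.of_forall fun y => ?_)
  have h1 : 0 ≤ κ y := zero_le_one.trans (hκ y).1
  rw [Real.norm_of_nonneg (by positivity)]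
  exact mul_le_mul_of_nonneg_right (hκ y).2 (by positivity)

theorem bigLam_nonneg {d : ℕ} {α : ℝ} {κ : EuclideanSpace ℝ (Fin d) → ℝ}
    (hκ : ∀ y, 0 ≤ κ y) : 0 ≤ bigLam d α κ :=
  integral_nonneg fun y => mul_nonneg (hκ y) (by positivity)

theorem bigLam_le {d : ℕ} {α κ₁ : ℝ} (hα : 0 < α) {κ : EuclideanSpace ℝ (Fin d) → ℝ}
    (hκm : Measurable κ) (hκ : ∀ y, 1 ≤ κ y ∧ κ y ≤ κ₁) :
    bigLam d α κ ≤ κ₁ * bigLam d α fun _ => 1 := by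
  unfold bigLam
  rw [← integral_const_mul]
  refine integral_mono (integrableOn_largeJumps hα hκm hκ)
    ((integrableOn_largeJumps hα (κ := fun _ => 1) measurable_const
      fun _ => ⟨le_rfl, le_rfl⟩).const_mul κ₁) fun y => ?_
  simpa using mul_le_mul_of_nonneg_right (hκ y).2 (by positivity)

theorem lintegral_largeJumps {d : ℕ} {α κ₁ : ℝ} (hα : 0 < α) {κ : EuclideanSpace ℝ (Fin d) → ℝ}
    (hκm : Measurable κ) (hκ : ∀ y, 1 ≤ κ y ∧ κ y ≤ κ₁) :
    ∫⁻ y : EuclideanSpace ℝ (Fin d),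
        ENNReal.ofReal (if 1 < ‖y‖ then κ y * ‖y‖ ^ (-(d : ℝ) - α) else 0) =
      ENNReal.ofReal (bigLam d α κ) := by
  have hm : MeasurableSet {y : EuclideanSpace ℝ (Fin d) | 1 < ‖y‖} :=
    measurableSet_lt (by fun_prop) (by fun_prop)
  unfold bigLam
  rw [ofReal_integral_eq_lintegral_ofReal (integrableOn_largeJumps hα hκm hκ)
    (Filter.Eventually.of_forall fun y =>
      mul_nonneg (zero_le_one.trans (hκ y).1) (by positivity)), ← lintegral_indicator hm]
  refine lintegral_congr fun y => ?_
  by_cases hy : 1 < ‖y‖ <;> simp [hy]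

/-- Bound for the `n`-th term of the series in `bigS`, without its Poisson weight. -/
theorem enorm_setIntegral_jumps_le {d : ℕ} {α κ₁ : ℝ} (hα : 0 < α)
    {κ : EuclideanSpace ℝ (Fin d) → ℝ} (hκm : Measurable κ) (hκ : ∀ y, 1 ≤ κ y ∧ κ y ≤ κ₁)
    (x v : EuclideanSpace ℝ (Fin d)) (n : ℕ) :
    ‖∫ s in Set.univ.pi fun _ : Fin (n + 1) => Set.Icc (0 : ℝ) 1,
        ∫ y : Fin (n + 1) → EuclideanSpace ℝ (Fin d),
          (if ‖(∑ j, s j • y j) - x‖ ≤ 1 then (1 : ℝ) else 0) *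
            (if ‖(∑ j, y j) - v‖ ≤ 1 then (1 : ℝ) else 0) *
            ∏ j, (if 1 < ‖y j‖ then κ (y j) * ‖y j‖ ^ (-(d : ℝ) - α) else 0)‖ₑ ≤
      ENNReal.ofReal ((n + 1) * ((κ₁ * ((5 * ((n : ℝ) + 1)) ^ ((d : ℝ) + α) *
          (√(‖x‖ ^ 2 + ‖v‖ ^ 2) + 1) ^ (-((d : ℝ) + α)))) *
        (volume.real (Metric.closedBall (0 : EuclideanSpace ℝ (Fin d)) 1) *
          ((∫ r in (0 : ℝ)..1, (‖x - r • v‖ + 1) ^ (-((d : ℝ) + α))) *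
            (6 ^ ((d : ℝ) + α) * bigLam d α κ ^ n +
              n * ((κ₁ * (2 * ((n : ℝ) + 1)) ^ ((d : ℝ) + α)) *
                (volume.real (Metric.closedBall (0 : EuclideanSpace ℝ (Fin d)) 2) *
                  bigLam d α κ ^ (n - 1)))))))) := by
  have hK : 0 ≤ κ₁ := zero_le_one.trans ((hκ 0).1.trans (hκ 0).2)
  have hL := bigLam_nonneg (α := α) fun y => zero_le_one.trans (hκ y).1
  have hnn : ∀ t : EuclideanSpace ℝ (Fin d),
      0 ≤ (if 1 < ‖t‖ then κ t * ‖t‖ ^ (-(d : ℝ) - α) else 0) := fun t => by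
    split_ifs
    · exact mul_nonneg (zero_le_one.trans (hκ t).1) (by positivity)
    · exact le_rfl
  set g : EuclideanSpace ℝ (Fin d) → ℝ≥0∞ := fun t =>
    ENNReal.ofReal (if 1 < ‖t‖ then κ t * ‖t‖ ^ (-(d : ℝ) - α) else 0) with hgdef
  have hg : Measurable g := by
    refine ENNReal.measurable_ofReal.comp (Measurable.ite
      (measurableSet_lt (by fun_prop) (by fun_prop)) (by fun_prop) measurable_const)
  have hgK : ∀ t, g t ≤ ENNReal.ofReal (κ₁ * ‖t‖ ^ (-((d : ℝ) + α))) := fun t => by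
    refine ENNReal.ofReal_le_ofReal ?_
    rw [neg_add, ← sub_eq_add_neg]
    split_ifs
    · exact mul_le_mul_of_nonneg_right (hκ t).2 (by positivity)
    · positivity
  have hg0 : ∀ t, ‖t‖ ≤ 1 → g t = 0 := fun t ht => by simp [hgdef, not_lt.2 ht]
  have hh : Continuous fun r : ℝ => (‖x - r • v‖ + 1) ^ (-((d : ℝ) + α)) :=
    Continuous.rpow_const (by fun_prop) fun r => Or.inl (by positivity)
  have hint : ∫⁻ r in Set.Icc (0 : ℝ) 1, ENNReal.ofReal ((‖x - r • v‖ + 1) ^ (-((d : ℝ) + α))) =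
      ENNReal.ofReal (∫ r in (0 : ℝ)..1, (‖x - r • v‖ + 1) ^ (-((d : ℝ) + α))) := by
    rw [intervalIntegral.integral_of_le zero_le_one, ← integral_Icc_eq_integral_Ioc,
      ofReal_integral_eq_lintegral_ofReal hh.continuousOn.integrableOn_Icc
        (Filter.Eventually.of_forall fun r => by positivity)]
  have hJ : 0 ≤ ∫ r in (0 : ℝ)..1, (‖x - r • v‖ + 1) ^ (-((d : ℝ) + α)) :=
    intervalIntegral.integral_nonneg zero_le_one fun r _ => by positivity
  calc _ ≤ ∫⁻ s in Set.univ.pi fun _ : Fin (n + 1) => Set.Icc (0 : ℝ) 1,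
        ∑ j, ENNReal.ofReal (κ₁ * ((5 * ((n : ℝ) + 1)) ^ ((d : ℝ) + α) *
          (√(‖x‖ ^ 2 + ‖v‖ ^ 2) + 1) ^ (-((d : ℝ) + α)))) *
        (volume (Metric.closedBall (0 : EuclideanSpace ℝ (Fin d)) 1) *
          (ENNReal.ofReal ((‖x - s j • v‖ + 1) ^ (-((d : ℝ) + α))) *
            (ENNReal.ofReal (6 ^ ((d : ℝ) + α)) * (∫⁻ t, g t) ^ n +
              n * (ENNReal.ofReal (κ₁ * (2 * ((n : ℝ) + 1)) ^ ((d : ℝ) + α)) *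
                (volume (Metric.closedBall (0 : EuclideanSpace ℝ (Fin d)) 2) *
                  (∫⁻ t, g t) ^ (n - 1)))))) := by
        refine (enorm_integral_le_lintegral_enorm _).trans (setLIntegral_mono'
          (MeasurableSet.univ_pi fun _ => measurableSet_Icc) fun s hs => ?_)
        refine (enorm_integral_le_lintegral_enorm _).trans (le_trans (le_of_eq ?_)
          (lintegral_jump_density_le hα hK hg hgK hg0 (fun j => hs j (Set.mem_univ j)) x v))
        refine lintegral_congr fun y => ?_
        rw [enorm_mul, enorm_mul, Real.enorm_of_nonneg (Finset.prod_nonneg fun j _ => hnn (y j)),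
          ENNReal.ofReal_prod_of_nonneg fun j _ => hnn (y j)]
        congr 2 <;> split_ifs <;> simp
    _ = ∑ _j : Fin (n + 1), ENNReal.ofReal (κ₁ * ((5 * ((n : ℝ) + 1)) ^ ((d : ℝ) + α) *
          (√(‖x‖ ^ 2 + ‖v‖ ^ 2) + 1) ^ (-((d : ℝ) + α)))) *
        (volume (Metric.closedBall (0 : EuclideanSpace ℝ (Fin d)) 1) *
          (ENNReal.ofReal (∫ r in (0 : ℝ)..1, (‖x - r • v‖ + 1) ^ (-((d : ℝ) + α))) *
            (ENNReal.ofReal (6 ^ ((d : ℝ) + α)) * (∫⁻ t, g t) ^ n +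
              n * (ENNReal.ofReal (κ₁ * (2 * ((n : ℝ) + 1)) ^ ((d : ℝ) + α)) *
                (volume (Metric.closedBall (0 : EuclideanSpace ℝ (Fin d)) 2) *
                  (∫⁻ t, g t) ^ (n - 1)))))) := by
        have hhm : Measurable fun r : ℝ =>
            ENNReal.ofReal ((‖x - r • v‖ + 1) ^ (-((d : ℝ) + α))) :=
          ENNReal.measurable_ofReal.comp hh.measurable
        have hhj : ∀ j : Fin (n + 1), Measurable fun s : Fin (n + 1) → ℝ =>
            ENNReal.ofReal ((‖x - s j • v‖ + 1) ^ (-((d : ℝ) + α))) :=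
          fun j => hhm.comp (measurable_pi_apply j)
        rw [lintegral_finsetSum _ fun j _ => (((hhj j).mul_const _).const_mul _).const_mul _]
        refine Finset.sum_congr rfl fun j _ => ?_
        rw [lintegral_const_mul _ (((hhj j).mul_const _).const_mul _),
          lintegral_const_mul _ ((hhj j).mul_const _), lintegral_mul_const _ (hhj j),
          lintegral_unitCube_eval hhm, hint]
    _ = _ := by
        rw [Finset.sum_const, Finset.card_univ, Fintype.card_fin, nsmul_eq_mul,
          lintegral_largeJumps hα hκm hκ, ← ofReal_measureReal measure_closedBall_lt_top.ne,
          ← ofReal_measureReal measure_closedBall_lt_top.ne, ← ENNReal.ofReal_natCast (n + 1),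
          ← ENNReal.ofReal_natCast n]
        simp only [← ENNReal.ofReal_pow hL]
        repeat first
          | rw [← ENNReal.ofReal_mul (by positivity)]
          | rw [← ENNReal.ofReal_add (by positivity) (by positivity)]
        push_cast
        rfl

theorem enorm_bigS_le {d : ℕ} {α κ₁ : ℝ} (hα : 0 < α)
    {κ : EuclideanSpace ℝ (Fin d) → ℝ} (hκm : Measurable κ) (hκ : ∀ y, 1 ≤ κ y ∧ κ y ≤ κ₁)
    (x v : EuclideanSpace ℝ (Fin d)) {m : ℕ} (hm : 2 * ((d : ℝ) + α) ≤ m) :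
    ‖bigS d α κ x v‖ₑ ≤ ENNReal.ofReal (κ₁ ^ 2 * (√(‖x‖ ^ 2 + ‖v‖ ^ 2) + 1) ^ (-((d : ℝ) + α)) *
      (∫ r in (0 : ℝ)..1, (‖x - r • v‖ + 1) ^ (-((d : ℝ) + α))) *
      (volume.real (Metric.closedBall (0 : EuclideanSpace ℝ (Fin d)) 1) *
        (30 ^ ((d : ℝ) + α) + 10 ^ ((d : ℝ) + α) *
          volume.real (Metric.closedBall (0 : EuclideanSpace ℝ (Fin d)) 2))) *
      (2 * (2 + m + bigLam d α κ) ^ m)) := by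
  have hK : 1 ≤ κ₁ := (hκ 0).1.trans (hκ 0).2
  have hL := bigLam_nonneg (α := α) fun y => zero_le_one.trans (hκ y).1
  have hJ : 0 ≤ ∫ r in (0 : ℝ)..1, (‖x - r • v‖ + 1) ^ (-((d : ℝ) + α)) :=
    intervalIntegral.integral_nonneg zero_le_one fun r _ => by positivity
  have hβ : 0 ≤ (d : ℝ) + α := by positivity
  have hterm := enorm_setIntegral_jumps_le hα hκm hκ x v
  unfold bigS
  set L := bigLam d α κ
  set J := ∫ r in (0 : ℝ)..1, (‖x - r • v‖ + 1) ^ (-((d : ℝ) + α))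
  set Z := (√(‖x‖ ^ 2 + ‖v‖ ^ 2) + 1) ^ (-((d : ℝ) + α))
  have hZ : 0 ≤ Z := by positivity
  set V₁ := volume.real (Metric.closedBall (0 : EuclideanSpace ℝ (Fin d)) 1)
  set V₂ := volume.real (Metric.closedBall (0 : EuclideanSpace ℝ (Fin d)) 2)
  have hV₁ : 0 ≤ V₁ := measureReal_nonneg
  have hV₂ : 0 ≤ V₂ := measureReal_nonneg
  set β := (d : ℝ) + α
  set D := Real.exp (-L) * κ₁ ^ 2 * Z * J * (V₁ * (30 ^ β + 10 ^ β * V₂)) with hD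
  have hD0 : 0 ≤ D := by positivity
  set w : ℕ → ℝ≥0∞ := fun n => ENNReal.ofReal (((n + 1 : ℕ) : ℝ) ^ m * (L ^ n / n.factorial))
  set w' : ℕ → ℝ≥0∞ := fun n =>
    ENNReal.ofReal (((n + 1 : ℕ) : ℝ) ^ m * (n * L ^ (n - 1) / n.factorial))
  have hbound : ∀ n, ‖(Real.exp (-L) / ((n + 1).factorial : ℝ)) *
      ∫ s in Set.univ.pi fun _ : Fin (n + 1) => Set.Icc (0 : ℝ) 1,
        ∫ y : Fin (n + 1) → EuclideanSpace ℝ (Fin d),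
          (if ‖(∑ j, s j • y j) - x‖ ≤ 1 then (1 : ℝ) else 0) *
            (if ‖(∑ j, y j) - v‖ ≤ 1 then (1 : ℝ) else 0) *
            ∏ j, (if 1 < ‖y j‖ then κ (y j) * ‖y j‖ ^ (-(d : ℝ) - α) else 0)‖ₑ ≤
      ENNReal.ofReal D * (w n + w' n) := by
    intro n
    rw [enorm_mul, Real.enorm_of_nonneg (by positivity)]
    refine (mul_le_mul_right (hterm n) _).trans ?_
    rw [← ENNReal.ofReal_mul (by positivity), ← ENNReal.ofReal_add (by positivity) (by positivity),
      ← ENNReal.ofReal_mul hD0]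
    refine ENNReal.ofReal_le_ofReal ?_
    have hn1 : (1 : ℝ) ≤ (n : ℝ) + 1 := by simp
    have hp2 : ((n : ℝ) + 1) ^ β * ((n : ℝ) + 1) ^ β ≤ ((n : ℝ) + 1) ^ m := by
      rw [← Real.rpow_add (by positivity), ← Real.rpow_natCast]
      exact Real.rpow_le_rpow_of_exponent_le hn1 (by linarith)
    have hp1 : ((n : ℝ) + 1) ^ β ≤ ((n : ℝ) + 1) ^ m := by
      rw [← Real.rpow_natCast]
      exact Real.rpow_le_rpow_of_exponent_le hn1 (by linarith)
    have e30 : (30 : ℝ) ^ β = 5 ^ β * 6 ^ β := by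
      rw [← Real.mul_rpow (by norm_num) (by norm_num)]; norm_num
    have e10 : (10 : ℝ) ^ β = 5 ^ β * 2 ^ β := by
      rw [← Real.mul_rpow (by norm_num) (by norm_num)]; norm_num
    rw [Real.mul_rpow (by norm_num) (by positivity), Real.mul_rpow (by norm_num) (by positivity),
      Nat.factorial_succ]
    push_cast
    set p := ((n : ℝ) + 1) ^ β
    set q := ((n : ℝ) + 1) ^ m
    have hA : 0 ≤ L ^ n / n.factorial := by positivity
    have hB : 0 ≤ n * L ^ (n - 1) / n.factorial := by positivity
    set A := L ^ n / n.factorial with hAdef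
    set B := n * L ^ (n - 1) / n.factorial with hBdef
    calc _ = Real.exp (-L) * κ₁ * Z * J * V₁ *
          (30 ^ β * (p * A) + 10 ^ β * V₂ * (κ₁ * (p * p * B))) := by
          rw [e30, e10, hAdef, hBdef]
          field_simp
      _ ≤ Real.exp (-L) * κ₁ * Z * J * V₁ *
          (30 ^ β * (κ₁ * (q * A)) + 10 ^ β * V₂ * (κ₁ * (q * B))) := by
          have hpA : p * A ≤ κ₁ * (q * A) :=
            (mul_le_mul_of_nonneg_right hp1 hA).trans (le_mul_of_one_le_left (by positivity) hK)
          gcongr ?_ * (30 ^ β * ?_ + 10 ^ β * V₂ * (κ₁ * (?_ * B)))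
      _ ≤ Real.exp (-L) * κ₁ * Z * J * V₁ * ((30 ^ β + 10 ^ β * V₂) * (κ₁ * (q * A + q * B))) := by
          gcongr
          have h1 : 0 ≤ 30 ^ β * (κ₁ * (q * B)) := by positivity
          have h2 : 0 ≤ 10 ^ β * V₂ * (κ₁ * (q * A)) := by positivity
          linarith
      _ = _ := by rw [hD]; ring
  have hw : ∑' n, w n ≤ ENNReal.ofReal ((2 + m + L) ^ m * Real.exp L) := by
    refine (tsum_poisson_moment_le hL m 1).trans (ENNReal.ofReal_le_ofReal ?_)
    push_cast
    gcongr
    norm_num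
  have hw' : ∑' n, w' n ≤ ENNReal.ofReal ((2 + m + L) ^ m * Real.exp L) := by
    rw [tsum_eq_zero_add' ENNReal.summable]
    have h0 : w' 0 = 0 := by simp [w']
    have hs : ∀ n, w' (n + 1) =
        ENNReal.ofReal (((n + 2 : ℕ) : ℝ) ^ m * (L ^ n / n.factorial)) := by
      intro n
      simp only [w', Nat.add_sub_cancel, Nat.factorial_succ]
      congr 1
      push_cast
      rw [add_assoc (n : ℝ) 1 1, one_add_one_eq_two]
      field_simp
    simp_rw [h0, hs, zero_add]
    exact_mod_cast tsum_poisson_moment_le hL m 2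
  refine enorm_tsum_le_tsum_enorm.trans ((ENNReal.tsum_le_tsum hbound).trans ?_)
  rw [ENNReal.tsum_mul_left, ENNReal.tsum_add]
  refine (mul_le_mul_right (add_le_add hw hw') _).trans (le_of_eq ?_)
  rw [← ENNReal.ofReal_add (by positivity) (by positivity), ← ENNReal.ofReal_mul hD0]
  congr 1
  have he : Real.exp (-L) * Real.exp L = 1 := by rw [← Real.exp_add]; simp
  calc _ = (Real.exp (-L) * Real.exp L) * (κ₁ ^ 2 * Z * J * (V₁ * (30 ^ β + 10 ^ β * V₂)) *
        (2 * (2 + m + L) ^ m)) := by rw [hD]; ring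
    _ = _ := by rw [he, one_mul]

/-- upper bound for the large-jump probability `S(z)`. -/
theorem stmt_13 (d : ℕ) (hd : 1 ≤ d) (α : ℝ) (hα : α ∈ Set.Ioo (0 : ℝ) 2) :
    ∃ C > (0 : ℝ), ∀ (κ : EuclideanSpace ℝ (Fin d) → ℝ) (κ₁ : ℝ), 1 ≤ κ₁ →
      Measurable κ → (∀ y, 1 ≤ κ y ∧ κ y ≤ κ₁) →
      ∀ x v : EuclideanSpace ℝ (Fin d),
        bigS d α κ x v ≤
          C * κ₁ ^ (3 + 2 * (d : ℝ) + 2 * α) *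
            (Real.sqrt (‖x‖ ^ 2 + ‖v‖ ^ 2) + 1) ^ (-((d : ℝ) + α)) *
            ∫ s in (0 : ℝ)..1, (‖x - s • v‖ + 1) ^ (-((d : ℝ) + α)) := by
  obtain ⟨hα0, -⟩ := hα
  set m := ⌈2 * ((d : ℝ) + α)⌉₊
  set P := volume.real (Metric.closedBall (0 : EuclideanSpace ℝ (Fin d)) 1) *
    (30 ^ ((d : ℝ) + α) + 10 ^ ((d : ℝ) + α) *
      volume.real (Metric.closedBall (0 : EuclideanSpace ℝ (Fin d)) 2))
  have hP : 0 ≤ P := by positivity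
  have hL₀ : 0 ≤ bigLam d α fun _ => 1 := bigLam_nonneg fun _ => zero_le_one
  set L₀ := bigLam d α fun _ => 1
  refine ⟨P * (2 * (2 + m + L₀) ^ m) + 1, by positivity, fun κ κ₁ hκ₁ hκm hκ x v => ?_⟩
  have hJ : 0 ≤ ∫ r in (0 : ℝ)..1, (‖x - r • v‖ + 1) ^ (-((d : ℝ) + α)) :=
    intervalIntegral.integral_nonneg zero_le_one fun r _ => by positivity
  have hL := bigLam_nonneg (α := α) fun y => zero_le_one.trans (hκ y).1
  have hLL := bigLam_le hα0 hκm hκ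
  have hS := enorm_bigS_le hα0 hκm hκ x v (Nat.le_ceil (2 * ((d : ℝ) + α)))
  rw [Real.enorm_eq_ofReal_abs, ENNReal.ofReal_le_ofReal_iff (by positivity)] at hS
  refine (le_abs_self _).trans (hS.trans ?_)
  set J := ∫ r in (0 : ℝ)..1, (‖x - r • v‖ + 1) ^ (-((d : ℝ) + α))
  set Z := (√(‖x‖ ^ 2 + ‖v‖ ^ 2) + 1) ^ (-((d : ℝ) + α))
  have hZ : 0 ≤ Z := by positivity
  have hmom : (2 + m + bigLam d α κ) ^ m ≤ κ₁ ^ m * (2 + m + L₀) ^ m := by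
    rw [← mul_pow]
    gcongr
    have : (2 + m : ℝ) ≤ κ₁ * (2 + m) := le_mul_of_one_le_left (by positivity) hκ₁
    linarith
  have hexp : κ₁ ^ 2 * κ₁ ^ m ≤ κ₁ ^ (3 + 2 * (d : ℝ) + 2 * α) := by
    rw [← pow_add, ← Real.rpow_natCast]
    refine Real.rpow_le_rpow_of_exponent_le hκ₁ ?_
    have := Nat.ceil_lt_add_one (show 0 ≤ 2 * ((d : ℝ) + α) by positivity)
    push_cast
    linarith
  calc κ₁ ^ 2 * Z * J * P * (2 * (2 + m + bigLam d α κ) ^ m)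
      ≤ κ₁ ^ 2 * Z * J * P * (2 * (κ₁ ^ m * (2 + m + L₀) ^ m)) := by gcongr
    _ = (P * (2 * (2 + m + L₀) ^ m)) * (κ₁ ^ 2 * κ₁ ^ m) * Z * J := by ring
    _ ≤ (P * (2 * (2 + m + L₀) ^ m) + 1) * κ₁ ^ (3 + 2 * (d : ℝ) + 2 * α) * Z * J := by
        gcongr
        linarith
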